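/- Let d₁, d₂ ≥ 1, 1 ≤ p ≤ 2 with conjugate exponent p', and 1 ≤ q ≤ 2 ≤ r ≤ ∞. If there exists a constant C > 0 such that ||𝓟_1 f||_{L_x^r L_t^{p'}} ≤ C ||f||_{L_x^q L_t^p} for all Schwartz functions f on ℝ^{d₁}×ℝ^{d₂}, then p ≤ 2(d₂+1)/(d₂+3). -/

import Mathlib

open MeasureTheory
open scoped ENNReal

noncomputable section

/-- Physicists' Hermite polynomial. -/
def physHermite (k : ℕ) (τ : ℝ) : ℝ :=
  (-1 : ℝ) ^ k * Real.exp (τ ^ 2) * iteratedDeriv k (fun s : ℝ => Real.exp (-s ^ 2)) τ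

/-- Hermite function -/
def hermiteFun (k : ℕ) (τ : ℝ) : ℝ :=
  ((2 : ℝ) ^ k * (Nat.factorial k) * Real.sqrt Real.pi) ^ (-(1 : ℝ) / 2) *
    physHermite k τ * Real.exp (-τ ^ 2 / 2)

/-- multi-dim Hermite function -/
def hermiteFunMulti (d : ℕ) (ν : Fin d → ℕ) (x : Fin d → ℝ) : ℝ :=
  ∏ j, hermiteFun (ν j) (x j)

/-- scaled Hermite function Φ^a_ν -/
def scaledHermite (d : ℕ) (a : ℝ) (ν : Fin d → ℕ) (x : Fin d → ℝ) : ℝ :=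
  |a| ^ ((d : ℝ) / 4) * hermiteFunMulti d ν (fun j => Real.sqrt |a| * x j)

/-- spectral projection P_k(a) -/
def hermiteProj (d k : ℕ) (a : ℝ) (φ : (Fin d → ℝ) → ℂ) (x : Fin d → ℝ) : ℂ :=
  ∑ ν ∈ Finset.Nat.antidiagonalTuple d k,
    (∫ y : Fin d → ℝ, φ y * (scaledHermite d a ν y : ℂ)) * (scaledHermite d a ν x : ℂ)

/-- surface measure on unit sphere -/
def sphereMeasure (n : ℕ) : Measure (Metric.sphere (0 : EuclideanSpace ℝ (Fin n)) 1) :=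
  (volume : Measure (EuclideanSpace ℝ (Fin n))).toSphere

/-- inverse partial Fourier transform in t -/
def partialFT (d₁ d₂ : ℕ) (f : (Fin d₁ → ℝ) × (Fin d₂ → ℝ) → ℂ)
    (lam : Fin d₂ → ℝ) (x : Fin d₁ → ℝ) : ℂ :=
  ∫ t : Fin d₂ → ℝ, f (x, t) * Complex.exp (Complex.I * (∑ j, lam j * t j : ℝ))

/-- the restriction operator 𝓟_μ -/
def restOp (d₁ d₂ : ℕ) (μ : ℝ) (f : (Fin d₁ → ℝ) × (Fin d₂ → ℝ) → ℂ)
    (x : Fin d₁ → ℝ) (t : Fin d₂ → ℝ) : ℂ :=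
  (1 / (2 * Real.pi) : ℝ) * ∑' k : ℕ,
    ((μ ^ (d₂ - 1) / (2 * (k : ℝ) + d₁) ^ d₂ : ℝ) : ℂ) *
      ∫ ε : Metric.sphere (0 : EuclideanSpace ℝ (Fin d₂)) 1,
        hermiteProj d₁ k (μ / (2 * (k : ℝ) + d₁))
          (partialFT d₁ d₂ f (fun j => μ / (2 * (k : ℝ) + d₁) * (ε : EuclideanSpace ℝ (Fin d₂)) j)) x *
        Complex.exp (-Complex.I *
          (μ * (∑ j, t j * (ε : EuclideanSpace ℝ (Fin d₂)) j) / (2 * (k : ℝ) + d₁) : ℝ))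
        ∂(sphereMeasure d₂)

/-- L^p norm (extended) of an ℝ≥0∞-valued function -/
def lpNormENN {α : Type*} [MeasurableSpace α] (p : ℝ≥0∞) (g : α → ℝ≥0∞) (μ : Measure α) : ℝ≥0∞ :=
  if p = ∞ then essSup g μ
  else (∫⁻ a, g a ^ p.toReal ∂μ) ^ (1 / p.toReal)

/-- mixed norm ‖f‖_{L_x^q L_t^p} -/
def mixedNorm (d₁ d₂ : ℕ) (q p : ℝ≥0∞) (f : (Fin d₁ → ℝ) × (Fin d₂ → ℝ) → ℂ) : ℝ≥0∞ :=
  lpNormENN p (fun t => eLpNorm (fun x => f (x, t)) q volume) volume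

end

open scoped SchwartzMap FourierTransform

/-- The tensor product `(x, t) ↦ f x * g t` of two Schwartz functions. -/
noncomputable def SchwartzMap.tensor {E F : Type*} [NormedAddCommGroup E] [NormedSpace ℝ E]
    [NormedAddCommGroup F] [NormedSpace ℝ F] (f : 𝓢(E, ℂ)) (g : 𝓢(F, ℂ)) : 𝓢(E × F, ℂ) where
  toFun z := f z.1 * g z.2
  smooth' := ((f.smooth ⊤).comp contDiff_fst).mul ((g.smooth ⊤).comp contDiff_snd)
  decay' := by
    intro k n
    choose A hA0 hA using f.decay
    choose B hB0 hB using g.decay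
    have hf : ContDiff ℝ n fun z : E × F => f z.1 := (f.smooth n).comp contDiff_fst
    have hg : ContDiff ℝ n fun z : E × F => g z.2 := (g.smooth n).comp contDiff_snd
    have hfst (i : ℕ) (z : E × F) :
        ‖iteratedFDeriv ℝ i (fun z : E × F => f z.1) z‖ ≤ ‖iteratedFDeriv ℝ i f z.1‖ := by
      have h := (ContinuousLinearMap.fst ℝ E F).iteratedFDeriv_comp_right
        (f.smooth i) z (i := i) le_rfl
      have h' : (f ∘ (ContinuousLinearMap.fst ℝ E F)) = fun z : E × F => f z.1 := rfl
      rw [h'] at h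
      rw [h]
      refine (ContinuousMultilinearMap.norm_compContinuousLinearMap_le _ _).trans ?_
      refine mul_le_of_le_one_right (norm_nonneg _) (Finset.prod_le_one (fun _ _ => norm_nonneg _)
        fun _ _ => ContinuousLinearMap.norm_fst_le ℝ E F)
    have hsnd (i : ℕ) (z : E × F) :
        ‖iteratedFDeriv ℝ i (fun z : E × F => g z.2) z‖ ≤ ‖iteratedFDeriv ℝ i g z.2‖ := by
      have h := (ContinuousLinearMap.snd ℝ E F).iteratedFDeriv_comp_right
        (g.smooth i) z (i := i) le_rfl
      have h' : (g ∘ (ContinuousLinearMap.snd ℝ E F)) = fun z : E × F => g z.2 := rfl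
      rw [h'] at h
      rw [h]
      refine (ContinuousMultilinearMap.norm_compContinuousLinearMap_le _ _).trans ?_
      refine mul_le_of_le_one_right (norm_nonneg _) (Finset.prod_le_one (fun _ _ => norm_nonneg _)
        fun _ _ => ContinuousLinearMap.norm_snd_le ℝ E F)
    refine ⟨∑ i ∈ Finset.range (n + 1), (n.choose i : ℝ) *
      (A k i * B 0 (n - i) + A 0 i * B k (n - i)), fun z => ?_⟩
    have hz : ‖z‖ ^ k ≤ ‖z.1‖ ^ k + ‖z.2‖ ^ k := by
      rcases max_choice ‖z.1‖ ‖z.2‖ with h | h <;> rw [Prod.norm_def, h] <;>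
        simp only [le_add_iff_nonneg_left, le_add_iff_nonneg_right] <;> positivity
    calc ‖z‖ ^ k * ‖iteratedFDeriv ℝ n (fun z : E × F => f z.1 * g z.2) z‖
        ≤ (‖z.1‖ ^ k + ‖z.2‖ ^ k) * ∑ i ∈ Finset.range (n + 1), (n.choose i : ℝ) *
            ‖iteratedFDeriv ℝ i f z.1‖ * ‖iteratedFDeriv ℝ (n - i) g z.2‖ := by
          gcongr
          refine (norm_iteratedFDeriv_mul_le hf hg z (n := n) le_rfl).trans ?_
          gcongr with i hi
          · exact hfst i z
          · exact hsnd _ z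
      _ ≤ _ := by
          rw [Finset.mul_sum]
          refine Finset.sum_le_sum fun i _ => ?_
          have h1 := mul_le_mul (hA k i z.1) (hB 0 (n - i) z.2) (by positivity)
            ((by positivity : (0 : ℝ) ≤ _).trans (hA k i z.1))
          have h2 := mul_le_mul (hA 0 i z.1) (hB k (n - i) z.2) (by positivity)
            ((by positivity : (0 : ℝ) ≤ _).trans (hA 0 i z.1))
          simp only [pow_zero, one_mul] at h1 h2
          calc _ = (n.choose i : ℝ) * (‖z.1‖ ^ k * ‖iteratedFDeriv ℝ i f z.1‖ *
                ‖iteratedFDeriv ℝ (n - i) g z.2‖ + ‖iteratedFDeriv ℝ i f z.1‖ *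
                (‖z.2‖ ^ k * ‖iteratedFDeriv ℝ (n - i) g z.2‖)) := by ring
            _ ≤ _ := by gcongr

theorem hasTemperateGrowth_cexp_mul_I :
    Function.HasTemperateGrowth fun x : ℝ => Complex.exp (x * Complex.I) := by
  have hd (n : ℕ) (x : ℝ) : iteratedDeriv n (fun x : ℝ => Complex.exp (x * Complex.I)) x =
      Complex.I ^ n * Complex.exp (x * Complex.I) := by
    induction n generalizing x with
    | zero => simp
    | succ n ih =>
      rw [iteratedDeriv_succ, funext ih]
      have h : HasDerivAt (fun x : ℝ => Complex.exp (x * Complex.I))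
          (Complex.exp (x * Complex.I) * (1 * Complex.I)) x :=
        (((hasDerivAt_id x).ofReal_comp).mul_const Complex.I).cexp
      rw [(h.const_mul _).deriv]
      ring
  refine ⟨(Complex.ofRealCLM.contDiff.mul contDiff_const).cexp, fun n => ⟨0, 1, fun x => ?_⟩⟩
  rw [norm_iteratedFDeriv_eq_norm_iteratedDeriv, hd]
  simp [Complex.norm_exp_ofReal_mul_I]

/-- A Schwartz function whose Fourier transform is compactly supported and equal to `1` on the
unit cube. -/
theorem exists_schwartz_fourier_bump (d : ℕ) : ∃ Ψ : 𝓢(Fin d → ℝ, ℂ), ∃ M : ℝ,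
    (∀ l : Fin d → ℝ, (∀ i, |l i| ≤ 1) →
      ∫ t, Ψ t * Complex.exp (Complex.I * (∑ j, l j * t j : ℝ)) = 1) ∧
    (∀ l : Fin d → ℝ, (∃ i, M < |l i|) →
      ∫ t, Ψ t * Complex.exp (Complex.I * (∑ j, l j * t j : ℝ)) = 0) := by
  let χ : ContDiffBump (0 : EuclideanSpace ℝ (Fin d)) := ⟨d + 1, d + 2, by positivity, by linarith⟩
  have hχs : HasCompactSupport fun x => (χ x : ℂ) :=
    χ.hasCompactSupport.comp_left (g := Complex.ofReal) rfl
  let X : 𝓢(EuclideanSpace ℝ (Fin d), ℂ) :=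
    hχs.toSchwartzMap (Complex.ofRealCLM.contDiff.comp χ.contDiff)
  let Ψ : 𝓢(Fin d → ℝ, ℂ) := SchwartzMap.compCLMOfContinuousLinearEquiv ℂ
    (EuclideanSpace.equiv (Fin d) ℝ).symm (𝓕 X)
  have key (l : Fin d → ℝ) : ∫ t, Ψ t * Complex.exp (Complex.I * (∑ j, l j * t j : ℝ)) =
      (χ (WithLp.toLp 2 fun i => (2 * Real.pi)⁻¹ * l i) : ℂ) := by
    have h1 : (𝓕⁻ (𝓕 X)) (WithLp.toLp 2 fun i => (2 * Real.pi)⁻¹ * l i) =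
        (χ (WithLp.toLp 2 fun i => (2 * Real.pi)⁻¹ * l i) : ℂ) := by
      rw [FourierTransform.fourierInv_fourier_eq]
      rfl
    rw [← h1, SchwartzMap.fourierInv_coe, Real.fourierInv_eq',
      ← (PiLp.volume_preserving_toLp (Fin d)).integral_comp
        (MeasurableEquiv.toLp 2 _).measurableEmbedding]
    refine integral_congr_ae (.of_forall fun t => ?_)
    have hΨ : Ψ t = (𝓕 X) (WithLp.toLp 2 t) := rfl
    simp only [smul_eq_mul]
    rw [hΨ, SchwartzMap.fourier_coe, mul_comm]
    congr 2
    rw [mul_comm]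
    congr 2
    simp only [PiLp.inner_apply, RCLike.inner_apply, conj_trivial, Finset.mul_sum]
    refine Finset.sum_congr rfl fun i _ => ?_
    field_simp
  have hpi : 0 < (2 * Real.pi)⁻¹ := by positivity
  have hpi1 : (2 * Real.pi)⁻¹ ≤ 1 := inv_le_one_of_one_le₀ (by linarith [Real.pi_gt_three])
  refine ⟨Ψ, 2 * Real.pi * (d + 2), fun l hl => ?_, fun l ⟨i, hi⟩ => ?_⟩
  · rw [key, χ.one_of_mem_closedBall, Complex.ofReal_one]
    rw [mem_closedBall_zero_iff]
    have h1 : ‖(WithLp.toLp 2 fun i => (2 * Real.pi)⁻¹ * l i : EuclideanSpace ℝ (Fin d))‖ ^ 2 ≤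
        d := by
      rw [EuclideanSpace.norm_sq_eq]
      calc _ ≤ ∑ i : Fin d, (1 : ℝ) := by
            refine Finset.sum_le_sum fun i _ => ?_
            rw [Real.norm_eq_abs, abs_mul, abs_of_pos hpi]
            exact pow_le_one₀ (by positivity) (mul_le_one₀ hpi1 (abs_nonneg _) (hl i))
        _ = d := by simp
    have hd : (0 : ℝ) ≤ d := by positivity
    change _ ≤ (d : ℝ) + 1
    nlinarith
  · rw [key, χ.zero_of_le_dist, Complex.ofReal_zero]
    rw [dist_zero_right]
    refine le_trans ?_ (PiLp.norm_apply_le _ i)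
    rw [Real.norm_eq_abs, abs_mul, abs_of_pos hpi]
    change (d : ℝ) + 2 ≤ _
    rw [inv_mul_eq_div, le_div_iff₀ (by positivity)]
    linarith

/-- Lebesgue measure under the anisotropic dilation shrinking coordinate `0` by `s ^ 2` and the
other coordinates by `s`. -/
theorem map_parabolic_dilation_volume (m : ℕ) {s : ℝ} (hs : 0 < s) :
    Measure.map (fun (t : Fin (m + 1) → ℝ) i => t i / s ^ (if i = 0 then 2 else 1)) volume =
      ENNReal.ofReal (s ^ (m + 2)) • volume := by
  let D : Fin (m + 1) → ℝ := fun i => (s ^ (if i = 0 then 2 else 1))⁻¹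
  have hdet : (Matrix.diagonal D).det = (s ^ (m + 2))⁻¹ := by
    rw [Matrix.det_diagonal, Fin.prod_univ_succ]
    simp [D, Fin.succ_ne_zero, ← mul_inv, ← pow_add, add_comm]
  have h0 : (Matrix.diagonal D).det ≠ 0 := by rw [hdet]; positivity
  have hD : (fun (t : Fin (m + 1) → ℝ) i => t i / s ^ (if i = 0 then 2 else 1)) =
      Matrix.toLin' (Matrix.diagonal D) := by
    ext t i
    simp [D, Matrix.mulVec_diagonal, div_eq_mul_inv, mul_comm]
  rw [hD, Real.map_matrix_volume_pi_eq_smul_volume_pi h0, hdet, inv_inv, abs_of_pos (by positivity)]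

/-- The anisotropic dilation shrinking coordinate `0` by `s ^ 2` and the other ones by `s`. -/
noncomputable def parabolicDilation (m : ℕ) {s : ℝ} (hs : 0 < s) :
    (Fin (m + 1) → ℝ) ≃L[ℝ] (Fin (m + 1) → ℝ) :=
  ContinuousLinearEquiv.piCongrRight fun i =>
    ContinuousLinearEquiv.unitsEquivAut ℝ (Units.mk0 (s ^ (if i = 0 then 2 else 1))⁻¹ (by positivity))

theorem parabolicDilation_apply (m : ℕ) {s : ℝ} (hs : 0 < s) (t : Fin (m + 1) → ℝ) :
    parabolicDilation m hs t = fun i => t i / s ^ (if i = 0 then 2 else 1) := by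
  ext i
  simp [parabolicDilation, div_eq_mul_inv]

theorem map_parabolicDilation_volume (m : ℕ) {s : ℝ} (hs : 0 < s) :
    Measure.map (parabolicDilation m hs) volume = ENNReal.ofReal (s ^ (m + 2)) • volume := by
  rw [← map_parabolic_dilation_volume m hs]
  exact congrArg (fun g => Measure.map g volume) (funext (parabolicDilation_apply m hs))

theorem integral_comp_parabolicDilation (m : ℕ) {s : ℝ} (hs : 0 < s) (h : (Fin (m + 1) → ℝ) → ℂ) :
    ∫ t, h (parabolicDilation m hs t) = s ^ (m + 2) * ∫ t, h t := by
  have := (parabolicDilation m hs).toHomeomorph.measurableEmbedding.integral_map (μ := volume) h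
  refine this.symm.trans ?_
  change ∫ t, h t ∂(Measure.map (parabolicDilation m hs) volume) = _
  rw [map_parabolicDilation_volume, integral_smul_measure,
    ENNReal.toReal_ofReal (by positivity), Complex.real_smul, Complex.ofReal_pow]

theorem eLpNorm_comp_parabolicDilation (m : ℕ) {s : ℝ} (hs : 0 < s) (h : (Fin (m + 1) → ℝ) → ℂ)
    {p : ℝ≥0∞} (hp : p ≠ ∞) :
    eLpNorm (fun t => h (parabolicDilation m hs t)) p volume =
      ENNReal.ofReal (s ^ (m + 2)) ^ (1 / p).toReal * eLpNorm h p volume := by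
  have := (parabolicDilation m hs).toHomeomorph.measurableEmbedding.eLpNorm_map_measure
    (g := h) (p := p) (μ := volume)
  change eLpNorm (h ∘ (parabolicDilation m hs)) p volume = _
  rw [← smul_eq_mul, ← eLpNorm_smul_measure_of_ne_top hp, ← map_parabolicDilation_volume m hs]
  exact this.symm

open scoped Pointwise in
/-- A cap of the unit sphere of dimensions `s⁻¹` (tangential) and `s⁻²` (normal) has surface
measure at least a constant multiple of `s ^ (-m)`. -/
theorem sphereMeasure_cap_lower_bound (m : ℕ) : ∃ c > (0 : ℝ), ∀ s : ℝ, 1 ≤ s →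
    ENNReal.ofReal (c / s ^ m) ≤ sphereMeasure (m + 1)
      {ε | |(ε : EuclideanSpace ℝ (Fin (m + 1))) 0 - 1| ≤ 1 / s ^ 2 ∧
        ∀ j, j ≠ 0 → |(ε : EuclideanSpace ℝ (Fin (m + 1))) j| ≤ 1 / s} := by
  set η : ℝ := 1 / (4 * (m + 1)) with hη
  have hη0 : 0 < η := by positivity
  refine ⟨1 / 4 * (2 * η) ^ m, by positivity, fun s hs => ?_⟩
  have hs0 : 0 < s := by linarith
  have hmeas : MeasurableSet {ε : Metric.sphere (0 : EuclideanSpace ℝ (Fin (m + 1))) 1 |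
      |(ε : EuclideanSpace ℝ (Fin (m + 1))) 0 - 1| ≤ 1 / s ^ 2 ∧
        ∀ j, j ≠ 0 → |(ε : EuclideanSpace ℝ (Fin (m + 1))) j| ≤ 1 / s} := by
    refine IsClosed.measurableSet ?_
    simp only [Set.ofPred_and, Set.ofPred_forall]
    refine IsClosed.inter (isClosed_le (by fun_prop) (by fun_prop)) ?_
    exact isClosed_iInter fun j => isClosed_iInter fun _ => isClosed_le (by fun_prop) (by fun_prop)
  let lo : Fin (m + 1) → ℝ := Fin.cons (1 / 4) fun _ => -(η / s)
  let hi : Fin (m + 1) → ℝ := Fin.cons (1 / 2) fun _ => η / s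
  have hvol : (volume : Measure (EuclideanSpace ℝ (Fin (m + 1))))
      (WithLp.ofLp ⁻¹' Set.Icc lo hi) = ENNReal.ofReal (1 / 4 * (2 * η) ^ m / s ^ m) := by
    rw [(PiLp.volume_preserving_ofLp (Fin (m + 1))).measure_preimage
      measurableSet_Icc.nullMeasurableSet, Real.volume_Icc_pi, Fin.prod_univ_succ]
    simp only [lo, hi, Fin.cons_zero, Fin.cons_succ, Finset.prod_const, Finset.card_univ,
      Fintype.card_fin]
    rw [← ENNReal.ofReal_pow (by rw [sub_neg_eq_add]; positivity), ← ENNReal.ofReal_mul (by norm_num)]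
    congr 1
    rw [sub_neg_eq_add, ← two_mul, ← mul_div_assoc, div_pow]
    ring
  rw [sphereMeasure, Measure.toSphere_apply' _ hmeas, ← hvol]
  refine le_trans (measure_mono fun x hx => ?_) (le_mul_of_one_le_left zero_le (by simp))
  have hx0 := And.intro (hx.1 0) (hx.2 0)
  simp only [lo, hi, Fin.cons_zero] at hx0
  obtain ⟨hx0l, hx0u⟩ := hx0
  have hxj (j : Fin m) : |x j.succ| ≤ η / s :=
    abs_le.2 ⟨by simpa [lo] using hx.1 j.succ, by simpa [hi] using hx.2 j.succ⟩
  have hsq : ‖x‖ ^ 2 ≤ x 0 ^ 2 + m * (η / s) ^ 2 := by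
    rw [EuclideanSpace.norm_sq_eq, Fin.sum_univ_succ, Real.norm_eq_abs, sq_abs]
    gcongr
    calc _ ≤ ∑ _j : Fin m, (η / s) ^ 2 := by
          gcongr with j
          exact hxj j
      _ = _ := by simp
  have hx0n : x 0 ≤ ‖x‖ := (le_abs_self _).trans (PiLp.norm_apply_le x 0)
  have hmη : m * η ^ 2 ≤ 1 / 64 := by
    rw [hη, div_pow, one_pow, mul_one_div, div_le_div_iff₀ (by positivity) (by norm_num)]
    nlinarith [sq_nonneg ((m : ℝ) - 1)]
  have hη4 : 4 * η ≤ 1 := by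
    rw [hη, mul_one_div, div_le_one (by positivity)]
    linarith [(Nat.cast_nonneg m : (0 : ℝ) ≤ m)]
  have hdiff : (‖x‖ - x 0) ≤ 1 / 32 / s ^ 2 := by
    have h1 : (‖x‖ - x 0) * (1 / 2) ≤ (‖x‖ - x 0) * (‖x‖ + x 0) :=
      mul_le_mul_of_nonneg_left (by linarith) (by linarith)
    have h2 : m * (η / s) ^ 2 ≤ 1 / 64 / s ^ 2 := by
      rw [div_pow, ← mul_div_assoc]
      gcongr
    have h3 : (1 : ℝ) / 32 / s ^ 2 = 2 * (1 / 64 / s ^ 2) := by ring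
    nlinarith
  have hs2 : (1 : ℝ) / 32 / s ^ 2 ≤ 1 / 32 := div_le_self (by norm_num) (one_le_pow₀ hs)
  have hn : 0 < ‖x‖ := by linarith
  refine Set.mem_smul.2 ⟨‖x‖, ⟨hn, by linarith⟩, ‖x‖⁻¹ • x, ⟨⟨‖x‖⁻¹ • x, ?_⟩, ⟨?_, ?_⟩, rfl⟩, ?_⟩
  · rw [mem_sphere_zero_iff_norm, norm_smul, norm_inv, norm_norm, inv_mul_cancel₀ hn.ne']
  · simp only [PiLp.smul_apply, smul_eq_mul]
    rw [abs_sub_comm, abs_of_nonneg]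
    · have h1 : 1 - ‖x‖⁻¹ * x 0 = ‖x‖⁻¹ * (‖x‖ - x 0) := by
        rw [mul_sub, inv_mul_cancel₀ hn.ne']
      rw [h1, inv_mul_le_iff₀ hn]
      refine hdiff.trans ?_
      rw [mul_one_div]
      gcongr
      linarith
    · rw [sub_nonneg, inv_mul_le_one₀ hn]
      exact hx0n
  · intro j hj
    obtain ⟨i, rfl⟩ := Fin.exists_succ_eq.2 hj
    simp only [PiLp.smul_apply, smul_eq_mul]
    rw [abs_mul, abs_of_pos (inv_pos.2 hn), inv_mul_le_iff₀ hn]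
    refine (hxj i).trans ?_
    rw [← mul_div_assoc, mul_one]
    gcongr
    linarith
  · exact smul_inv_smul₀ hn.ne' x

/-- The Fourier transform `l ↦ ∫ ψ t * exp (i l · t)` on `ℝ ^ d`. -/
noncomputable def fourierPi {d : ℕ} (ψ : (Fin d → ℝ) → ℂ) (l : Fin d → ℝ) : ℂ :=
  ∫ t, ψ t * Complex.exp (Complex.I * (∑ j, l j * t j : ℝ))

/-- The Fourier extension from the sphere of radius `c` of the restriction of the Fourier
transform of `ψ`. -/
noncomputable def sphereRestrictExtend {d : ℕ} (c : ℝ) (ψ : (Fin d → ℝ) → ℂ) (t : Fin d → ℝ) : ℂ :=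
  ∫ ε : Metric.sphere (0 : EuclideanSpace ℝ (Fin d)) 1,
    fourierPi ψ (fun j => c * (ε : EuclideanSpace ℝ (Fin d)) j) *
      Complex.exp (-Complex.I * (c * ∑ j, t j * (ε : EuclideanSpace ℝ (Fin d)) j : ℝ))
    ∂(sphereMeasure d)

instance (d : ℕ) : IsFiniteMeasure (sphereMeasure d) := by
  unfold sphereMeasure
  infer_instance

theorem norm_cexp_I_mul_ofReal (x : ℝ) : ‖Complex.exp (Complex.I * x)‖ = 1 := by
  rw [mul_comm, Complex.norm_exp_ofReal_mul_I]

theorem norm_cexp_neg_I_mul_ofReal (x : ℝ) : ‖Complex.exp (-Complex.I * x)‖ = 1 := by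
  rw [neg_mul, ← mul_neg, ← Complex.ofReal_neg, norm_cexp_I_mul_ofReal]

theorem continuous_fourierPi {d : ℕ} (ψ : 𝓢(Fin d → ℝ, ℂ)) : Continuous (fourierPi ψ) := by
  refine continuous_of_dominated (bound := fun t => ‖ψ t‖) (fun l => ?_) (fun l => ?_)
    ψ.integrable.norm (.of_forall fun t => ?_)
  · exact (ψ.continuous.mul (by fun_prop)).aestronglyMeasurable
  · exact .of_forall fun t => by rw [norm_mul, norm_cexp_I_mul_ofReal, mul_one]
  · fun_prop

theorem norm_fourierPi_le {d : ℕ} (ψ : (Fin d → ℝ) → ℂ) (l : Fin d → ℝ) :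
    ‖fourierPi ψ l‖ ≤ ∫ t, ‖ψ t‖ := by
  refine (norm_integral_le_integral_norm _).trans_eq ?_
  simp_rw [norm_mul, norm_cexp_I_mul_ofReal, mul_one]

theorem stronglyMeasurable_sphereRestrictExtend {d : ℕ} (c : ℝ) (ψ : 𝓢(Fin d → ℝ, ℂ)) :
    StronglyMeasurable (sphereRestrictExtend c ψ) := by
  refine StronglyMeasurable.integral_prod_right' (f := fun z : (Fin d → ℝ) ×
    Metric.sphere (0 : EuclideanSpace ℝ (Fin d)) 1 =>
      fourierPi ψ (fun j => c * (z.2 : EuclideanSpace ℝ (Fin d)) j) *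
      Complex.exp (-Complex.I * (c * ∑ j, z.1 j * (z.2 : EuclideanSpace ℝ (Fin d)) j : ℝ))) ?_
  refine Continuous.stronglyMeasurable (Continuous.mul ?_ (by fun_prop))
  exact (continuous_fourierPi ψ).comp (by fun_prop)

theorem integral_sphereRestrictExtend_mul_conj {d : ℕ} (c : ℝ) (ψ : 𝓢(Fin d → ℝ, ℂ)) :
    ∫ t, sphereRestrictExtend c ψ t * star (ψ t) =
      ((∫ ε : Metric.sphere (0 : EuclideanSpace ℝ (Fin d)) 1,
        ‖fourierPi ψ (fun j => c * (ε : EuclideanSpace ℝ (Fin d)) j)‖ ^ 2 ∂(sphereMeasure d) : ℝ) :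
        ℂ) := by
  have hF : Continuous fun ε : Metric.sphere (0 : EuclideanSpace ℝ (Fin d)) 1 =>
      fourierPi ψ (fun j => c * (ε : EuclideanSpace ℝ (Fin d)) j) :=
    (continuous_fourierPi ψ).comp (by fun_prop)
  have hint : Integrable (Function.uncurry fun (t : Fin d → ℝ)
      (ε : Metric.sphere (0 : EuclideanSpace ℝ (Fin d)) 1) =>
      fourierPi ψ (fun j => c * (ε : EuclideanSpace ℝ (Fin d)) j) *
      Complex.exp (-Complex.I * (c * ∑ j, t j * (ε : EuclideanSpace ℝ (Fin d)) j : ℝ)) *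
        star (ψ t)) (volume.prod (sphereMeasure d)) := by
    have hdom : Integrable (fun z : (Fin d → ℝ) × Metric.sphere (0 : EuclideanSpace ℝ (Fin d)) 1 =>
        ‖ψ z.1‖ * ∫ t, ‖ψ t‖) (volume.prod (sphereMeasure d)) :=
      ψ.integrable.norm.mul_prod (integrable_const _)
    refine hdom.mono' (Continuous.aestronglyMeasurable ?_) (.of_forall fun z => ?_)
    · refine ((hF.comp continuous_snd).mul (by fun_prop)).mul ?_
      exact continuous_star.comp (ψ.continuous.comp continuous_fst)
    · simp only [Function.uncurry]
      rw [norm_mul, norm_mul, norm_cexp_neg_I_mul_ofReal, mul_one, norm_star, mul_comm]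
      gcongr
      exact norm_fourierPi_le _ _
  simp only [sphereRestrictExtend, ← integral_mul_const]
  rw [integral_integral_swap hint, ← integral_complex_ofReal]
  refine integral_congr_ae (.of_forall fun ε => ?_)
  simp only [mul_assoc, integral_const_mul]
  rw [Complex.ofReal_pow, ← Complex.mul_conj']
  congr 1
  rw [fourierPi, ← integral_conj]
  refine integral_congr_ae (.of_forall fun t => ?_)
  simp only [map_mul, ← Complex.exp_conj, Complex.conj_I, Complex.conj_ofReal, Complex.star_def]
  rw [mul_comm, Finset.mul_sum]
  congr 5
  ext j
  ring

theorem lintegral_fourierPi_sq_le {d : ℕ} (c : ℝ) (ψ : 𝓢(Fin d → ℝ, ℂ)) (p p' : ℝ≥0∞)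
    [ENNReal.HolderConjugate p' p] :
    ∫⁻ ε : Metric.sphere (0 : EuclideanSpace ℝ (Fin d)) 1,
        ‖fourierPi ψ (fun j => c * (ε : EuclideanSpace ℝ (Fin d)) j)‖ₑ ^ 2 ∂(sphereMeasure d) ≤
      eLpNorm (sphereRestrictExtend c ψ) p' volume * eLpNorm ψ p volume := by
  have hF : Continuous fun ε : Metric.sphere (0 : EuclideanSpace ℝ (Fin d)) 1 =>
      ‖fourierPi ψ (fun j => c * (ε : EuclideanSpace ℝ (Fin d)) j)‖ ^ 2 :=
    ((continuous_fourierPi ψ).comp (by fun_prop)).norm.pow 2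
  have hi : Integrable (fun ε : Metric.sphere (0 : EuclideanSpace ℝ (Fin d)) 1 =>
      ‖fourierPi ψ (fun j => c * (ε : EuclideanSpace ℝ (Fin d)) j)‖ ^ 2) (sphereMeasure d) := by
    refine Integrable.of_bound hF.aestronglyMeasurable ((∫ t, ‖ψ t‖) ^ 2) (.of_forall fun ε => ?_)
    rw [norm_pow, norm_norm]
    gcongr
    exact norm_fourierPi_le _ _
  calc _ = ENNReal.ofReal (∫ ε : Metric.sphere (0 : EuclideanSpace ℝ (Fin d)) 1,
        ‖fourierPi ψ (fun j => c * (ε : EuclideanSpace ℝ (Fin d)) j)‖ ^ 2 ∂(sphereMeasure d)) := by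
        rw [ofReal_integral_eq_lintegral_ofReal hi (.of_forall fun _ => by positivity)]
        refine lintegral_congr fun ε => ?_
        rw [ENNReal.ofReal_pow (norm_nonneg _), ofReal_norm]
    _ = ‖∫ t, sphereRestrictExtend c ψ t * star (ψ t)‖ₑ := by
        rw [integral_sphereRestrictExtend_mul_conj, ← ofReal_norm, Complex.norm_real,
          Real.norm_of_nonneg (integral_nonneg fun _ => by positivity)]
    _ ≤ ∫⁻ t, ‖sphereRestrictExtend c ψ t * star (ψ t)‖ₑ := enorm_integral_le_lintegral_enorm _
    _ = eLpNorm (sphereRestrictExtend c ψ • fun t => star (ψ t)) 1 volume := by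
        rw [eLpNorm_one_eq_lintegral_enorm]
        rfl
    _ ≤ eLpNorm (sphereRestrictExtend c ψ) p' volume * eLpNorm (fun t => star (ψ t)) p volume :=
        eLpNorm_smul_le_mul_eLpNorm
          (continuous_star.comp ψ.continuous).aestronglyMeasurable
          (stronglyMeasurable_sphereRestrictExtend c ψ).aestronglyMeasurable
    _ = _ := by
        congr 1
        exact eLpNorm_congr_norm_ae (.of_forall fun t => norm_star _)

/-- Parabolically rescaled wave packets with Fourier transform concentrated near `v e₀`. -/
theorem exists_knapp_family (m : ℕ) (v : ℝ) : ∃ Ψ : 𝓢(Fin (m + 1) → ℝ, ℂ), ∃ M : ℝ,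
    ∀ s : ℝ, 0 < s → ∃ ψ : 𝓢(Fin (m + 1) → ℝ, ℂ),
      (∀ l : Fin (m + 1) → ℝ, |l 0 - v| ≤ 1 / s ^ 2 → (∀ j, j ≠ 0 → |l j| ≤ 1 / s) →
        fourierPi ψ l = s ^ (m + 2)) ∧
      (∀ l : Fin (m + 1) → ℝ, M < s ^ 2 * |l 0 - v| → fourierPi ψ l = 0) ∧
      ∀ p : ℝ≥0∞, p ≠ ∞ → eLpNorm ψ p volume =
        ENNReal.ofReal (s ^ (m + 2)) ^ (1 / p).toReal * eLpNorm Ψ p volume := by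
  obtain ⟨Ψ, M, h1, h0⟩ := exists_schwartz_fourier_bump (m + 1)
  refine ⟨Ψ, M, fun s hs => ?_⟩
  have hg : Function.HasTemperateGrowth fun t : Fin (m + 1) → ℝ =>
      Complex.exp (((-v * t 0 : ℝ) : ℂ) * Complex.I) :=
    hasTemperateGrowth_cexp_mul_I.comp
      (-v • ContinuousLinearMap.proj (R := ℝ) (φ := fun _ : Fin (m + 1) => ℝ) 0).hasTemperateGrowth
  let ψ : 𝓢(Fin (m + 1) → ℝ, ℂ) := SchwartzMap.smulLeftCLM ℂ
    (fun t : Fin (m + 1) → ℝ => Complex.exp (((-v * t 0 : ℝ) : ℂ) * Complex.I))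
    (SchwartzMap.compCLMOfContinuousLinearEquiv ℂ (parabolicDilation m hs) Ψ)
  have hψ (t) : ψ t = Complex.exp (((-v * t 0 : ℝ) : ℂ) * Complex.I) *
      Ψ (parabolicDilation m hs t) := by
    simp only [ψ, SchwartzMap.smulLeftCLM_apply_apply hg, smul_eq_mul]
    rfl
  have hF (l : Fin (m + 1) → ℝ) : fourierPi ψ l = s ^ (m + 2) *
      ∫ t, Ψ t * Complex.exp (Complex.I * (∑ j, (s ^ (if j = 0 then 2 else 1) *
        (l j - if j = 0 then v else 0)) * t j : ℝ)) := by
    rw [← integral_comp_parabolicDilation m hs, fourierPi]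
    refine integral_congr_ae (.of_forall fun t => ?_)
    simp only [hψ]
    rw [mul_comm (Complex.exp _), mul_assoc, ← Complex.exp_add, mul_comm _ Complex.I, ← mul_add,
      ← Complex.ofReal_add]
    congr 4
    have (j : Fin (m + 1)) : s ^ (if j = 0 then 2 else 1) * (l j - if j = 0 then v else 0) *
        parabolicDilation m hs t j = l j * t j - (if j = 0 then v else 0) * t j := by
      rw [parabolicDilation_apply]
      field_simp
    simp only [this, Finset.sum_sub_distrib]
    simp
    ring
  refine ⟨ψ, fun l hl0 hl => ?_, fun l hl => ?_, fun p hp => ?_⟩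
  · rw [hF, h1, mul_one]
    intro i
    rw [abs_mul, abs_of_pos (by positivity), mul_comm, ← le_div_iff₀ (by positivity)]
    split_ifs with hi
    · rw [hi]; exact hl0
    · rw [sub_zero, pow_one]; exact hl i hi
  · rw [hF, h0, mul_zero]
    refine ⟨0, ?_⟩
    simp only [if_true]
    rw [abs_mul, abs_of_pos (by positivity)]
    exact hl
  · rw [← eLpNorm_comp_parabolicDilation m hs Ψ hp]
    refine eLpNorm_congr_norm_ae (.of_forall fun t => ?_)
    rw [hψ, norm_mul, Complex.norm_exp_ofReal_mul_I, one_mul]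

theorem hermiteFun_zero_pos (x : ℝ) : 0 < hermiteFun 0 x := by
  simp only [hermiteFun, physHermite, iteratedDeriv_zero]
  positivity

theorem continuous_hermiteFun_zero : Continuous (hermiteFun 0) := by
  unfold hermiteFun physHermite
  simp only [iteratedDeriv_zero]
  fun_prop

theorem scaledHermite_zero_pos (d : ℕ) {a : ℝ} (ha : 0 < a) (x : Fin d → ℝ) :
    0 < scaledHermite d a 0 x :=
  mul_pos (Real.rpow_pos_of_pos (abs_pos.2 ha.ne') _)
    (Finset.prod_pos fun _ _ => hermiteFun_zero_pos _)

theorem continuous_scaledHermite_zero (d : ℕ) (a : ℝ) : Continuous (scaledHermite d a 0) := by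
  refine continuous_const.mul (continuous_finsetProd _ fun j _ => ?_)
  exact continuous_hermiteFun_zero.comp (by fun_prop)

theorem hermiteProj_zero_apply (d : ℕ) (a : ℝ) (φ : (Fin d → ℝ) → ℂ) (x : Fin d → ℝ) :
    hermiteProj d 0 a φ x =
      (∫ y, φ y * (scaledHermite d a 0 y : ℂ)) * (scaledHermite d a 0 x : ℂ) := by
  simp [hermiteProj, Finset.Nat.antidiagonalTuple_zero_right]

theorem hermiteProj_mul_const (d k : ℕ) (a : ℝ) (φ : (Fin d → ℝ) → ℂ) (z : ℂ) (x : Fin d → ℝ) :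
    hermiteProj d k a (fun y => φ y * z) x = z * hermiteProj d k a φ x := by
  simp only [hermiteProj, mul_right_comm _ z, integral_mul_const, Finset.mul_sum]
  exact Finset.sum_congr rfl fun _ _ => by ring

theorem partialFT_tensor {d₁ d₂ : ℕ} (g : 𝓢(Fin d₁ → ℝ, ℂ)) (ψ : 𝓢(Fin d₂ → ℝ, ℂ))
    (l : Fin d₂ → ℝ) : partialFT d₁ d₂ (g.tensor ψ) l = fun x => g x * fourierPi ψ l := by
  ext x
  rw [fourierPi, ← integral_const_mul]
  exact integral_congr_ae (.of_forall fun t => mul_assoc _ _ _)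

/-- If the Fourier transform of `ψ` vanishes on the spheres of radius `1 / (2 k + d₁)`, `k ≥ 1`,
only the lowest Hermite component contributes to `restOp`. -/
theorem restOp_tensor {d₁ d₂ : ℕ} (g : 𝓢(Fin d₁ → ℝ, ℂ)) (ψ : 𝓢(Fin d₂ → ℝ, ℂ))
    (hψ : ∀ k : ℕ, k ≠ 0 → ∀ ε : Metric.sphere (0 : EuclideanSpace ℝ (Fin d₂)) 1,
      fourierPi ψ (fun j => 1 / (2 * (k : ℝ) + d₁) * (ε : EuclideanSpace ℝ (Fin d₂)) j) = 0)
    (x : Fin d₁ → ℝ) (t : Fin d₂ → ℝ) :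
    restOp d₁ d₂ 1 (g.tensor ψ) x t =
      ((1 / (2 * Real.pi) * (1 / (d₁ : ℝ) ^ d₂) : ℝ) : ℂ) * hermiteProj d₁ 0 (1 / d₁) g x *
        sphereRestrictExtend (1 / d₁) ψ t := by
  unfold restOp
  rw [tsum_eq_single 0]
  · simp only [partialFT_tensor, hermiteProj_mul_const, sphereRestrictExtend, Nat.cast_zero,
      mul_zero, zero_add, one_pow, one_mul]
    rw [Complex.ofReal_mul, mul_assoc, mul_assoc,
      ← integral_const_mul (hermiteProj d₁ 0 (1 / (d₁ : ℝ)) g x)]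
    congr 2
    refine integral_congr_ae (.of_forall fun ε => ?_)
    simp only
    rw [mul_comm (fourierPi _ _), mul_assoc, div_eq_inv_mul (Finset.sum _ _) (d₁ : ℝ), one_div]
  · intro k hk
    simp only [partialFT_tensor, hermiteProj_mul_const]
    simp only [hψ k hk, zero_mul, integral_zero, mul_zero]

theorem lpNormENN_const_mul_enorm {α : Type*} [MeasurableSpace α] {μ : Measure α} {p b : ℝ≥0∞}
    (hp : p ≠ 0) (hb : b ≠ ∞) (h : α → ℂ) :
    lpNormENN p (fun t => b * ‖h t‖ₑ) μ = b * eLpNorm h p μ := by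
  have hb' : b = ‖b.toReal‖ₑ := by
    rw [Real.enorm_of_nonneg ENNReal.toReal_nonneg, ENNReal.ofReal_toReal hb]
  have h1 : (fun t => b * ‖h t‖ₑ) = fun t => ‖(b.toReal • h) t‖ₑ := by
    ext t
    rw [Pi.smul_apply, enorm_smul, ← hb']
  have h2 : b * eLpNorm h p μ = eLpNorm (b.toReal • h) p μ := by
    rw [eLpNorm_const_smul, ← hb']
  rw [h1, h2, lpNormENN]
  split_ifs with hpt
  · rw [hpt, eLpNorm_exponent_top, eLpNormEssSup]
  · rw [eLpNorm_eq_lintegral_rpow_enorm_toReal hp hpt]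

theorem lpNormENN_mono {α : Type*} [MeasurableSpace α] {μ : Measure α} {p : ℝ≥0∞}
    {u v : α → ℝ≥0∞} (h : ∀ t, u t ≤ v t) : lpNormENN p u μ ≤ lpNormENN p v μ := by
  unfold lpNormENN
  split_ifs
  · exact essSup_mono_ae (.of_forall h)
  · gcongr with t
    exact h t

theorem eLpNorm_mul_const {α : Type*} [MeasurableSpace α] {μ : Measure α} (q : ℝ≥0∞)
    (u : α → ℂ) (z : ℂ) : eLpNorm (fun x => u x * z) q μ = eLpNorm u q μ * ‖z‖ₑ := by
  have : (fun x => u x * z) = z • u := by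
    ext x
    simp [mul_comm]
  rw [this, eLpNorm_const_smul, mul_comm]

theorem mixedNorm_mul_eq {d₁ d₂ : ℕ} {q p : ℝ≥0∞} (hp : p ≠ 0) (u : (Fin d₁ → ℝ) → ℂ)
    (h : (Fin d₂ → ℝ) → ℂ) (hu : eLpNorm u q volume ≠ ∞) :
    mixedNorm d₁ d₂ q p (fun z => u z.1 * h z.2) = eLpNorm u q volume * eLpNorm h p volume := by
  simp only [mixedNorm, eLpNorm_mul_const]
  exact lpNormENN_const_mul_enorm hp hu h

theorem le_mixedNorm_mul {d₁ d₂ : ℕ} {q p b : ℝ≥0∞} (hp : p ≠ 0) (u : (Fin d₁ → ℝ) → ℂ)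
    (h : (Fin d₂ → ℝ) → ℂ) (hb : b ≠ ∞) (hbu : b ≤ eLpNorm u q volume) :
    b * eLpNorm h p volume ≤ mixedNorm d₁ d₂ q p (fun z => u z.1 * h z.2) := by
  simp only [mixedNorm, eLpNorm_mul_const]
  rw [← lpNormENN_const_mul_enorm hp hb h]
  exact lpNormENN_mono fun t => by gcongr

theorem exists_schwartz_hermiteProj_zero_ne_zero (d : ℕ) {a : ℝ} (ha : 0 < a) :
    ∃ g : 𝓢(Fin d → ℝ, ℂ), Continuous (hermiteProj d 0 a g) ∧ hermiteProj d 0 a g 0 ≠ 0 := by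
  let χ : ContDiffBump (0 : Fin d → ℝ) := ⟨1, 2, by norm_num, by norm_num⟩
  have hχs : HasCompactSupport fun x => (χ x : ℂ) :=
    χ.hasCompactSupport.comp_left (g := Complex.ofReal) rfl
  let g : 𝓢(Fin d → ℝ, ℂ) :=
    hχs.toSchwartzMap (Complex.ofRealCLM.contDiff.comp χ.contDiff)
  have hg (y) : g y = (χ y : ℂ) := rfl
  have hcont := continuous_scaledHermite_zero d a
  have hpos : 0 < ∫ y, χ y * scaledHermite d a 0 y :=
    (χ.continuous.mul hcont).integral_pos_of_hasCompactSupport_nonneg_nonzero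
      χ.hasCompactSupport.mul_right (fun y => mul_nonneg χ.nonneg (scaledHermite_zero_pos d ha y).le)
      (x := 0) (mul_ne_zero (χ.pos_of_mem_ball (by simp [χ.rOut_pos])).ne'
        (scaledHermite_zero_pos d ha 0).ne')
  refine ⟨g, ?_, ?_⟩
  · simp only [funext (hermiteProj_zero_apply d a g)]
    fun_prop
  · rw [hermiteProj_zero_apply]
    simp only [hg, ← Complex.ofReal_mul, integral_complex_ofReal]
    exact_mod_cast (mul_pos hpos (scaledHermite_zero_pos d ha 0)).ne'

theorem le_of_forall_pow_le_mul_rpow {n : ℕ} {e c K s₀ : ℝ} (hc : 0 < c)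
    (h : ∀ s : ℝ, s₀ ≤ s → c * s ^ n ≤ K * s ^ e) : (n : ℝ) ≤ e := by
  by_contra! hlt
  obtain ⟨s, hs, hs0, hsK⟩ := ((Filter.eventually_ge_atTop s₀).and
    ((Filter.eventually_gt_atTop 0).and ((tendsto_rpow_atTop (sub_pos.2 hlt)).eventually_gt_atTop
      (K / c)))).exists
  rw [Real.rpow_sub hs0, Real.rpow_natCast, div_lt_div_iff₀ hc (by positivity)] at hsK
  linarith [h s hs]

/-- The lower bound `s ^ (m + 4)` for the `L²` norm on the sphere of the Fourier transform of a wave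
packet. -/
theorem knapp_lintegral_lower_bound (m : ℕ) {d₁ : ℕ} (hd₁ : 1 ≤ d₁) : ∃ c > (0 : ℝ), ∀ s : ℝ,
    1 ≤ s → ∀ ψ : 𝓢(Fin (m + 1) → ℝ, ℂ),
      (∀ l : Fin (m + 1) → ℝ, |l 0 - 1 / d₁| ≤ 1 / s ^ 2 → (∀ j, j ≠ 0 → |l j| ≤ 1 / s) →
        fourierPi ψ l = s ^ (m + 2)) →
      ENNReal.ofReal (c * s ^ (m + 4)) ≤
        ∫⁻ ε : Metric.sphere (0 : EuclideanSpace ℝ (Fin (m + 1))) 1,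
          ‖fourierPi ψ (fun j => 1 / d₁ * (ε : EuclideanSpace ℝ (Fin (m + 1))) j)‖ₑ ^ 2
            ∂(sphereMeasure (m + 1)) := by
  obtain ⟨c, hc, h⟩ := sphereMeasure_cap_lower_bound m
  refine ⟨c, hc, fun s hs ψ hψ => ?_⟩
  have hs0 : 0 < s := by linarith
  have hd : (1 : ℝ) ≤ d₁ := by exact_mod_cast hd₁
  have hd1 : (1 : ℝ) / d₁ ≤ 1 := by rw [div_le_one (by linarith)]; exact hd
  have hd0 : (0 : ℝ) ≤ 1 / d₁ := by positivity
  have hmeas : Measurable fun ε : Metric.sphere (0 : EuclideanSpace ℝ (Fin (m + 1))) 1 =>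
      ‖fourierPi ψ (fun j => 1 / d₁ * (ε : EuclideanSpace ℝ (Fin (m + 1))) j)‖ₑ ^ 2 :=
    (((continuous_fourierPi ψ).comp (by fun_prop)).measurable.enorm).pow_const 2
  refine le_trans ?_ (mul_meas_ge_le_lintegral hmeas (ENNReal.ofReal (s ^ (m + 2)) ^ 2))
  calc ENNReal.ofReal (c * s ^ (m + 4))
      = ENNReal.ofReal (s ^ (m + 2)) ^ 2 * ENNReal.ofReal (c / s ^ m) := by
        rw [← ENNReal.ofReal_pow (by positivity), ← ENNReal.ofReal_mul (by positivity)]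
        congr 1
        field_simp
        ring
    _ ≤ _ := by
        gcongr
        refine (h s hs).trans (measure_mono fun ε hε => ?_)
        rw [Set.mem_ofPred_eq, hψ, ← ofReal_norm, norm_pow, Complex.norm_real,
          Real.norm_of_nonneg hs0.le]
        · rw [← mul_sub_one, abs_mul, abs_of_nonneg hd0]
          exact (mul_le_of_le_one_left (abs_nonneg _) hd1).trans hε.1
        · intro j hj
          rw [abs_mul, abs_of_nonneg hd0]
          exact (mul_le_of_le_one_left (abs_nonneg _) hd1).trans (hε.2 j hj)

/-- The first coordinate of a point on a sphere of radius `1 / (2 k + d₁)`, `k ≥ 1`, stays away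
from `1 / d₁`. -/
theorem sub_le_abs_sphere_coord_sub {m d₁ : ℕ} (hd₁ : 1 ≤ d₁) {k : ℕ} (hk : k ≠ 0)
    (ε : Metric.sphere (0 : EuclideanSpace ℝ (Fin (m + 1))) 1) :
    (1 / d₁ - 1 / (d₁ + 2) : ℝ) ≤
      |1 / (2 * (k : ℝ) + d₁) * (ε : EuclideanSpace ℝ (Fin (m + 1))) 0 - 1 / d₁| := by
  have hd : (1 : ℝ) ≤ d₁ := by exact_mod_cast hd₁
  have hk1 : (1 : ℝ) ≤ k := by exact_mod_cast Nat.one_le_iff_ne_zero.2 hk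
  have hε : (ε : EuclideanSpace ℝ (Fin (m + 1))) 0 ≤ 1 :=
    (le_abs_self _).trans ((PiLp.norm_apply_le (ε : EuclideanSpace ℝ (Fin (m + 1))) 0).trans_eq
      (norm_eq_of_mem_sphere ε))
  have h1 : 1 / (2 * (k : ℝ) + d₁) * (ε : EuclideanSpace ℝ (Fin (m + 1))) 0 ≤ 1 / (d₁ + 2) := by
    refine (mul_le_of_le_one_right (by positivity) hε).trans ?_
    exact one_div_le_one_div_of_le (by positivity) (by linarith)
  rw [abs_sub_comm]
  exact le_trans (by linarith) (le_abs_self _)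

theorem sharpness_of_p (d₁ d₂ : ℕ) (hd₁ : 1 ≤ d₁) (hd₂ : 1 ≤ d₂)
    (p p' q r : ℝ≥0∞) (hp1 : 1 ≤ p) (hp2 : p ≤ 2) (hpp' : 1 / p + 1 / p' = 1)
    (hq1 : 1 ≤ q) (hq2 : q ≤ 2) (hr : 2 ≤ r)
    (H : ∃ C > (0 : ℝ), ∀ f : SchwartzMap ((Fin d₁ → ℝ) × (Fin d₂ → ℝ)) ℂ,
      mixedNorm d₁ d₂ r p' (fun z => restOp d₁ d₂ 1 (⇑f) z.1 z.2) ≤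
        ENNReal.ofReal C * mixedNorm d₁ d₂ q p (⇑f)) :
    p ≤ 2 * ((d₂ : ℝ≥0∞) + 1) / ((d₂ : ℝ≥0∞) + 3) := by
  obtain ⟨C, -, H⟩ := H
  obtain ⟨m, rfl⟩ : ∃ m, d₂ = m + 1 := ⟨d₂ - 1, by omega⟩
  have hp0 : p ≠ 0 := (zero_lt_one.trans_le hp1).ne'
  have hpt : p ≠ ∞ := (hp2.trans_lt (by norm_num)).ne
  have hp'0 : p' ≠ 0 := by
    rintro rfl
    simp at hpp'
  have : ENNReal.HolderConjugate p' p := by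
    rw [ENNReal.holderConjugate_iff, add_comm]
    simpa only [one_div] using hpp'
  have hd : (1 : ℝ) ≤ d₁ := by exact_mod_cast hd₁
  obtain ⟨g, hgc, hg0⟩ := exists_schwartz_hermiteProj_zero_ne_zero d₁ (a := 1 / d₁) (by positivity)
  obtain ⟨Ψ, M, hΨ⟩ := exists_knapp_family m (1 / d₁)
  obtain ⟨c, hc, hlow⟩ := knapp_lintegral_lower_bound m hd₁
  set u : (Fin d₁ → ℝ) → ℂ := fun x =>
    ((1 / (2 * Real.pi) * (1 / (d₁ : ℝ) ^ (m + 1)) : ℝ) : ℂ) * hermiteProj d₁ 0 (1 / d₁) g x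
  have hu : eLpNorm u r volume ≠ 0 := by
    have huc : Continuous u := continuous_const.mul hgc
    rw [Ne, eLpNorm_eq_zero_iff huc.aestronglyMeasurable (zero_lt_two.trans_le hr).ne',
      huc.ae_eq_iff_eq _ continuous_zero]
    intro h
    refine mul_ne_zero ?_ hg0 (congrFun h 0)
    rw [Complex.ofReal_ne_zero]
    positivity
  set b : ℝ≥0∞ := min (eLpNorm u r volume) 1 with hb
  have hb0 : b ≠ 0 := by simp [hb, hu]
  have hbt : b ≠ ∞ := ne_top_of_le_ne_top ENNReal.one_ne_top (min_le_right _ _)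
  have hQ := g.eLpNorm_lt_top q volume
  have hA := Ψ.eLpNorm_lt_top p volume
  set Q := eLpNorm g q volume
  set A := eLpNorm Ψ p volume
  set γ : ℝ := 1 / d₁ - 1 / (d₁ + 2) with hγ
  have hγ0 : 0 < γ := sub_pos.2 (by gcongr; linarith)
  have hP : 0 < p.toReal := ENNReal.toReal_pos hp0 hpt
  have main (s : ℝ) (hs : max 1 (M / γ + 1) ≤ s) :
      b.toReal * c * s ^ (m + 4) ≤
        (ENNReal.ofReal C * Q * A ^ 2).toReal * s ^ (2 * (m + 2) / p.toReal : ℝ) := by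
    have hs1 : 1 ≤ s := (le_max_left _ _).trans hs
    have hs0 : 0 < s := by linarith
    obtain ⟨ψ, hψ1, hψ0, hψn⟩ := hΨ s hs0
    have hMγ : M < s ^ 2 * γ := by
      have h1 : M / γ < s := by linarith [(le_max_right _ _).trans hs]
      rw [div_lt_iff₀ hγ0] at h1
      exact h1.trans_le (mul_le_mul_of_nonneg_right (by nlinarith) hγ0.le)
    have hH := H (g.tensor ψ)
    have hrest : (fun z : (Fin d₁ → ℝ) × (Fin (m + 1) → ℝ) =>
        restOp d₁ (m + 1) 1 (g.tensor ψ) z.1 z.2) =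
        fun z => u z.1 * sphereRestrictExtend (1 / d₁) ψ z.2 := by
      ext z
      refine restOp_tensor g ψ (fun k hk ε => hψ0 _ (hMγ.trans_le ?_)) z.1 z.2
      gcongr
      exact sub_le_abs_sphere_coord_sub hd₁ hk ε
    rw [hrest] at hH
    have hH' := (le_mixedNorm_mul hp'0 u (sphereRestrictExtend (1 / d₁) ψ) hbt
      (min_le_left _ _)).trans hH
    have hf : mixedNorm d₁ (m + 1) q p (g.tensor ψ) = Q * eLpNorm ψ p volume :=
      mixedNorm_mul_eq hp0 g ψ hQ.ne
    rw [hf, hψn p hpt] at hH'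
    have hlow' := (hlow s hs1 ψ hψ1).trans (lintegral_fourierPi_sq_le (1 / d₁) ψ p p')
    rw [hψn p hpt] at hlow'
    set N := ENNReal.ofReal (s ^ (m + 2)) ^ (1 / p).toReal with hN
    have hNN : N * N = ENNReal.ofReal (s ^ (2 * (m + 2) / p.toReal : ℝ)) := by
      rw [hN, ENNReal.ofReal_rpow_of_nonneg (by positivity) ENNReal.toReal_nonneg,
        ← ENNReal.ofReal_mul (by positivity), ← Real.rpow_natCast, ← Real.rpow_mul hs0.le,
        ← Real.rpow_add hs0, one_div, ENNReal.toReal_inv]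
      congr 2
      push_cast
      ring
    have hfin : b * ENNReal.ofReal (c * s ^ (m + 4)) ≤
        ENNReal.ofReal C * Q * A ^ 2 * ENNReal.ofReal (s ^ (2 * (m + 2) / p.toReal : ℝ)) := by
      calc _ ≤ b * (eLpNorm (sphereRestrictExtend (1 / d₁) ψ) p' volume * (N * A)) := by gcongr
        _ = b * eLpNorm (sphereRestrictExtend (1 / d₁) ψ) p' volume * (N * A) := by ring
        _ ≤ ENNReal.ofReal C * (Q * (N * A)) * (N * A) := by gcongr
        _ = ENNReal.ofReal C * Q * A ^ 2 * (N * N) := by ring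
        _ = _ := by rw [hNN]
    have htop : ENNReal.ofReal C * Q * A ^ 2 * ENNReal.ofReal (s ^ (2 * (m + 2) / p.toReal : ℝ)) ≠
        ∞ := by finiteness
    have := ENNReal.toReal_mono htop hfin
    rw [ENNReal.toReal_mul, ENNReal.toReal_mul (b := ENNReal.ofReal (s ^ _)),
      ENNReal.toReal_ofReal (by positivity), ENNReal.toReal_ofReal (by positivity)] at this
    linarith
  have hexp := le_of_forall_pow_le_mul_rpow (mul_pos (ENNReal.toReal_pos hb0 hbt) hc) main
  rw [le_div_iff₀ hP] at hexp
  rw [ENNReal.le_div_iff_mul_le (.inl (by positivity)) (.inl (by finiteness)),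
    ← ENNReal.toReal_le_toReal (by finiteness) (by finiteness), ENNReal.toReal_mul,
    ENNReal.toReal_mul, ENNReal.toReal_add (by finiteness) (by finiteness),
    ENNReal.toReal_add (by finiteness) (by finiteness)]
  simp only [ENNReal.toReal_natCast, ENNReal.toReal_ofNat, ENNReal.toReal_one]
  push_cast at hexp ⊢
  linarith
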